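/- arXiv:1902.09573 — 2 statements merged into one kernel-verified Lean document; each statement's English description precedes it below -/
import Mathlib

section
/- In the compactification construction, if x ∈ I and (x,y) is in the closure Ê of the edge set E in (J,d)², then y ∈ I and xy ∈ E. Consequently I is a union of connected components of the graph (J, Ê). -/
open MeasureTheory

/-- The ball of graph radius `r` around `x` in the graph `G` (as a vertex set,
including `x` itself). -/
def gball {I : Type*} (G : I → I → Prop) (x : I) : ℕ → Set I
  | 0 => {x}
  | r + 1 => gball G x r ∪ {z | ∃ w ∈ gball G x r, G w z}

/-- An `r`-neighborhood isomorphism between `x` and `y`: a rooted isomorphism of the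
graph balls `B(x,r) → B(y,r)` sending `x` to `y` (encoded as a global map that is a
bijection between the balls preserving adjacency in both directions). -/
def IsNbhdIso {I : Type*} (G : I → I → Prop) (r : ℕ) (x y : I) (φ : I → I) : Prop :=
  φ x = y ∧ Set.BijOn φ (gball G x r) (gball G y r) ∧
    ∀ u ∈ gball G x r, ∀ v ∈ gball G x r, (G u v ↔ G (φ u) (φ v))

/-- The displacement `d₀(φ) = sup_{z ∈ B(x,r)} d₀(z, φ(z))` of a neighborhood map. -/
noncomputable def disp {I : Type*} [MetricSpace I] (G : I → I → Prop) (x : I) (r : ℕ)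
    (φ : I → I) : ℝ :=
  ⨆ z : gball G x r, dist (z : I) (φ z)

/-- The neighborhood-isomorphism metric
`d(x,y) = inf over r and r-neighborhood isomorphisms φ of max {1/(r+1), d₀(φ)}`. -/
noncomputable def nbhdDist {I : Type*} [MetricSpace I] (G : I → I → Prop) (x y : I) : ℝ :=
  sInf {m | ∃ (r : ℕ) (φ : I → I), IsNbhdIso G r x y φ ∧
    m = max (1 / ((r : ℝ) + 1)) (disp G x r φ)}

/-- `degIn G B x` is the number of neighbors of `x` in `B`. -/
noncomputable def degIn {I : Type*} (G : I → I → Prop) (B : Set I) (x : I) : ℕ :=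
  {y | y ∈ B ∧ G x y}.ncard

/-- The vertex set of the connected component of `x`. -/
def compSet {I : Type*} (G : I → I → Prop) (x : I) : Set I := {y | Relation.ReflTransGen G x y}

theorem gball_mono {I : Type*} (G : I → I → Prop) (x : I) {r s : ℕ} (h : r ≤ s) :
    gball G x r ⊆ gball G x s := by
  induction h with
  | refl => exact subset_rfl
  | step _ ih => exact ih.trans Set.subset_union_left

theorem self_mem_gball {I : Type*} (G : I → I → Prop) (x : I) (r : ℕ) : x ∈ gball G x r :=
  gball_mono G x (Nat.zero_le r) rfl

theorem gball_subset_of_adj {I : Type*} (G : I → I → Prop) {x c : I} (h : G x c) (s : ℕ) :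
    gball G c s ⊆ gball G x (s + 1) := by
  induction s with
  | zero =>
    rintro z rfl
    exact Or.inr ⟨x, rfl, h⟩
  | succ s ih =>
    rintro z (hz | ⟨w, hw, hwz⟩)
    · exact Or.inl (ih hz)
    · exact Or.inr ⟨w, ih hw, hwz⟩

theorem image_gball {I : Type*} (G : I → I → Prop) {x a c : I} {r : ℕ} {φ : I → I}
    (hφ : IsNbhdIso G r x a φ) (hc : G x c) (hac : G a (φ c)) (s : ℕ) (hs : s + 1 ≤ r) :
    φ '' gball G c s = gball G (φ c) s := by
  obtain ⟨h1, h2, h3⟩ := hφ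
  induction s with
  | zero => exact Set.image_singleton
  | succ s ih =>
    have ih := ih (by omega)
    have hsub : gball G c (s + 1) ⊆ gball G x r :=
      (gball_subset_of_adj G hc _).trans (gball_mono G x hs)
    have hsub' : gball G (φ c) (s + 1) ⊆ gball G a r :=
      (gball_subset_of_adj G hac _).trans (gball_mono G a hs)
    apply Set.Subset.antisymm
    · rintro _ ⟨z, hz, rfl⟩
      rcases id hz with hz' | ⟨w, hw, hwz⟩
      · exact Or.inl (ih ▸ Set.mem_image_of_mem φ hz')
      · exact Or.inr ⟨φ w, ih ▸ Set.mem_image_of_mem φ hw,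
          (h3 w (hsub (Or.inl hw)) z (hsub hz)).1 hwz⟩
    · intro v hv
      rcases id hv with hv' | ⟨u, hu, huv⟩
      · rw [← ih] at hv'
        exact Set.image_mono Set.subset_union_left hv'
      · rw [← ih] at hu
        obtain ⟨w, hw, rfl⟩ := hu
        obtain ⟨z, hz, rfl⟩ := h2.surjOn (hsub' hv)
        exact ⟨z, Or.inr ⟨w, hw, (h3 w (hsub (Or.inl hw)) z hz).2 huv⟩, rfl⟩

theorem nbhdIso_restrict {I : Type*} (G : I → I → Prop) {x a c : I} {s : ℕ} {φ : I → I}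
    (hφ : IsNbhdIso G (s + 1) x a φ) (hc : G x c) (hac : G a (φ c)) :
    IsNbhdIso G s c (φ c) φ := by
  have him := image_gball G hφ hc hac s le_rfl
  have hsub := gball_subset_of_adj G hc s
  refine ⟨rfl, ?_, fun u hu v hv => hφ.2.2 u (hsub hu) v (hsub hv)⟩
  rw [← him]
  exact (hφ.2.1.injOn.mono hsub).bijOn_image

theorem dist_le_disp {I : Type*} [MetricSpace I] (hdiam : ∀ x y : I, dist x y ≤ 1)
    (G : I → I → Prop) (x : I) (r : ℕ) (φ : I → I) {z : I} (hz : z ∈ gball G x r) :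
    dist z (φ z) ≤ disp G x r φ := by
  have hb : BddAbove (Set.range fun z : gball G x r => dist (z : I) (φ z)) :=
    ⟨1, by rintro _ ⟨z, rfl⟩; exact hdiam _ _⟩
  exact le_ciSup hb ⟨z, hz⟩

theorem exists_of_nbhdDist_lt {I : Type*} [MetricSpace I]
    (G : I → I → Prop) (hirr : ∀ x, ¬ G x x) {x y : I} {e : ℝ} (h : nbhdDist G x y < e) :
    ∃ (r : ℕ) (φ : I → I), IsNbhdIso G r x y φ ∧ 1 / ((r : ℝ) + 1) < e ∧ disp G x r φ < e := by
  have h0 : IsNbhdIso G 0 x y (fun _ => y) := by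
    refine ⟨rfl, by simp [gball], ?_⟩
    rintro u rfl v rfl
    simp [hirr]
  unfold nbhdDist at h
  obtain ⟨m, ⟨r, φ, hφ, rfl⟩, hm⟩ := exists_lt_of_csInf_lt (by exact ⟨_, 0, _, h0, rfl⟩) h
  exact ⟨r, φ, hφ, max_lt_iff.1 hm⟩

theorem nbhdDist_le {I : Type*} [MetricSpace I] (G : I → I → Prop) {x y : I} {r : ℕ}
    {φ : I → I} (h : IsNbhdIso G r x y φ) :
    nbhdDist G x y ≤ max (1 / ((r : ℝ) + 1)) (disp G x r φ) := by
  refine csInf_le ⟨0, ?_⟩ ⟨r, φ, h, rfl⟩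
  rintro _ ⟨r, φ, -, rfl⟩
  exact le_max_of_le_left (by positivity)

theorem exists_near {I : Type*} [MetricSpace I] (hdiam : ∀ x y : I, dist x y ≤ 1)
    (G : I → I → Prop) (hirr : ∀ x, ¬ G x x) {x a b : I} (hab : G a b) {e : ℝ} (he : e ≤ 1)
    (h : nbhdDist G x a < e) : ∃ c, G x c ∧ nbhdDist G c b ≤ 2 * e := by
  obtain ⟨r, φ, hφ, hr, hd⟩ := exists_of_nbhdDist_lt G hirr h
  obtain _ | s := r
  · norm_num at hr
    linarith
  have hb : b ∈ gball G a (s + 1) := gball_mono G a (by omega) (gball_subset_of_adj G hab 0 rfl)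
  obtain ⟨c, hc, rfl⟩ := hφ.2.1.surjOn hb
  have hxc : G x c := (hφ.2.2 x (self_mem_gball G x _) c hc).2 (by rw [hφ.1]; exact hab)
  refine ⟨c, hxc, (nbhdDist_le G (nbhdIso_restrict G hφ hxc hab)).trans (max_le ?_ ?_)⟩
  · push_cast at hr
    have h1 : (0 : ℝ) < (s : ℝ) + 1 := by positivity
    have h2 : (0 : ℝ) < (s : ℝ) + 1 + 1 := by positivity
    rw [div_lt_iff₀ h2] at hr
    rw [div_le_iff₀ h1]
    have : (0 : ℝ) ≤ s := by positivity
    have he0 : 0 < e := by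
      by_contra hcon
      nlinarith
    nlinarith
  · have he0 : 0 ≤ disp G x (s + 1) φ :=
      dist_nonneg.trans (dist_le_disp hdiam G x (s + 1) φ (self_mem_gball G x _))
    have : Nonempty (gball G c s) := ⟨⟨c, self_mem_gball G c s⟩⟩
    have : disp G c s φ ≤ disp G x (s + 1) φ :=
      ciSup_le fun z => dist_le_disp hdiam G x (s + 1) φ (gball_subset_of_adj G hxc s z.2)
    linarith

/-- if `x ∈ I` and `(x,y)` lies in the closure `Ê` of the edge set in the
completion `(J,d)²`, then `y ∈ I` and `xy ∈ E`; consequently `I` is a union of connected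
components of `(J, Ê)`. -/
theorem stmt6 {I : Type*} [MetricSpace I] [CompactSpace I] (hdiam : ∀ x y : I, dist x y ≤ 1)
    (G : I → I → Prop) (hsym : Symmetric G) (hirr : Irreflexive G)
    (D : ℕ) (hfin : ∀ x : I, {y | G x y}.Finite) (hdeg : ∀ x : I, {y | G x y}.ncard ≤ D)
    (J : Type*) [MetricSpace J] [CompleteSpace J] (f : I → J)
    (hiso : ∀ x y : I, dist (f x) (f y) = nbhdDist G x y)
    (hdense : DenseRange f)
    (Ehat : Set (J × J))
    (hEhat : Ehat = closure {p : J × J | ∃ a b : I, G a b ∧ p = (f a, f b)}) :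
    (∀ (x : I) (y : J), (f x, y) ∈ Ehat → ∃ y' : I, y = f y' ∧ G x y') ∧
    (∀ (x : I) (z : J),
      Relation.ReflTransGen (fun a b : J => (a, b) ∈ Ehat) (f x) z → z ∈ Set.range f) := by
  have key : ∀ (x : I) (y : J), (f x, y) ∈ Ehat → ∃ y' : I, y = f y' ∧ G x y' := by
    intro x y hxy
    have hcl : y ∈ closure (f '' {c | G x c}) := by
      rw [Metric.mem_closure_iff]
      intro ε hε
      rw [hEhat, Metric.mem_closure_iff] at hxy
      obtain ⟨_, ⟨a, b, hab, rfl⟩, hd⟩ := hxy (min 1 (ε / 4)) (by positivity)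
      rw [Prod.dist_eq, max_lt_iff] at hd
      obtain ⟨hd1, hd2⟩ := hd
      simp only at hd1 hd2
      rw [hiso] at hd1
      obtain ⟨c, hc, hcb⟩ := exists_near hdiam G (fun x hx => hirr x hx) hab (min_le_left _ _) hd1
      refine ⟨f c, ⟨c, hc, rfl⟩, ?_⟩
      rw [← hiso] at hcb
      have := dist_triangle_right y (f c) (f b)
      have := min_le_right 1 (ε / 4)
      linarith
    rw [((hfin x).image f).isClosed.closure_eq] at hcl
    obtain ⟨c, hc, rfl⟩ := hcl
    exact ⟨c, rfl, hc⟩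
  refine ⟨key, fun x z hz => ?_⟩
  induction hz with
  | refl => exact ⟨x, rfl⟩
  | tail _ hbc ih =>
    obtain ⟨b', rfl⟩ := ih
    obtain ⟨c', rfl, -⟩ := key _ _ hbc
    exact ⟨c', rfl⟩
end

section
/- Let G = (I, 𝒜, E, λ) be a graphing and A ∈ 𝒜. Then for almost every x ∈ A whose connected component G_x is infinite, the component G_x contains infinitely many points of A. -/
open MeasureTheory

/-- Bounded Lusin-Novikov: the section counting function is measurable. -/
lemma count_section_measurable.{u} {I : Type u} [MeasurableSpace I] [StandardBorelSpace I] (D : ℕ) :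
    ∀ {X : Type u} [MeasurableSpace X] [StandardBorelSpace X] (E : Set (X × I)),
      MeasurableSet E → (∀ x, (Prod.mk x ⁻¹' E).encard ≤ D) →
      Measurable (fun x => Measure.count (Prod.mk x ⁻¹' E)) := by
  induction D with
  | zero =>
    intro X _ _ E hE h
    have : (fun x => Measure.count (Prod.mk x ⁻¹' E)) = fun _ => 0 := by
      funext x
      have := h x
      simp only [Nat.cast_zero, nonpos_iff_eq_zero, Set.encard_eq_zero] at this
      rw [this]; simp
    rw [this]; exact measurable_const
  | succ D ih =>
    intro X _ _ E hE h
    obtain ⟨e, he⟩ : ∃ e : I → ℝ, MeasurableEmbedding e := ⟨_, measurableEmbedding_embeddingReal I⟩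
    set E' : Set ((X × I) × I) :=
      {p | p.1 ∈ E ∧ (p.1.1, p.2) ∈ E ∧ e p.2 < e p.1.2} with hE'
    have hE'm : MeasurableSet E' := by
      refine (measurable_fst hE).inter (MeasurableSet.inter ?_ ?_)
      · exact ((measurable_fst.comp measurable_fst).prodMk measurable_snd) hE
      · exact measurableSet_lt (he.measurable.comp measurable_snd)
          (he.measurable.comp (measurable_snd.comp measurable_fst))
    have hc := ih E' hE'm (by
      rintro ⟨x, y⟩
      by_cases hxy : (x, y) ∈ E
      · have hy : y ∉ Prod.mk (x, y) ⁻¹' E' := by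
          simp [hE']
        have h1 : insert y (Prod.mk (x, y) ⁻¹' E') ⊆ Prod.mk x ⁻¹' E := by
          intro z hz
          rcases hz with rfl | hz
          · exact hxy
          · exact hz.2.1
        have h2 := (Set.encard_le_encard h1).trans (h x)
        rw [Set.encard_insert_of_notMem hy] at h2
        push_cast at h2
        exact (ENat.add_le_add_iff_right (by simp)).1 h2
      · have : Prod.mk (x, y) ⁻¹' E' = ∅ := by
          ext z; simp [hE', hxy]
        rw [this]; simp)
    set M : Set (X × I) := E ∩ {p | Measure.count (Prod.mk p ⁻¹' E') = 0} with hM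
    have hMm : MeasurableSet M := hE.inter (hc (measurableSet_singleton 0))
    have hMmin : ∀ x y, (x, y) ∈ M ↔ (x, y) ∈ E ∧ ∀ z, (x, z) ∈ E → e y ≤ e z := by
      intro x y
      simp only [hM, Set.mem_inter_iff, Set.mem_setOf_eq, Measure.count_eq_zero_iff]
      refine and_congr_right fun hxy => ?_
      rw [Set.eq_empty_iff_forall_notMem]
      refine forall_congr' fun z => ?_
      simp only [hE', Set.mem_preimage, Set.mem_setOf_eq, hxy, true_and, not_and, not_lt]
    have hMinj : ∀ x y z, (x, y) ∈ M → (x, z) ∈ M → y = z := by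
      intro x y z hy hz
      rw [hMmin] at hy hz
      exact he.injective (le_antisymm (hy.2 z hz.1) (hz.2 y hy.1))
    have hMex : ∀ x, (Prod.mk x ⁻¹' E).Nonempty → ∃ y, (x, y) ∈ M := by
      intro x hx
      have hf : (Prod.mk x ⁻¹' E).Finite :=
        Set.finite_of_encard_le_coe (h x)
      obtain ⟨y, hy, hmin⟩ := Set.exists_min_image _ e hf hx
      exact ⟨y, (hMmin x y).2 ⟨hy, fun z hz => hmin z hz⟩⟩
    have hP : MeasurableSet (Prod.fst '' M) :=
      hMm.image_of_measurable_injOn measurable_fst (by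
        rintro ⟨x, y⟩ h1 ⟨x', z⟩ h2 (rfl : x = x')
        rw [hMinj x y z h1 h2])
    have hR := ih (E \ M) (hE.diff hMm) (by
      intro x
      rcases (Prod.mk x ⁻¹' E).eq_empty_or_nonempty with h0 | h0
      · have : Prod.mk x ⁻¹' (E \ M) = ∅ := by
          rw [Set.preimage_diff, h0, Set.empty_diff]
        rw [this]; simp
      · obtain ⟨y, hy⟩ := hMex x h0
        have hyn : y ∉ Prod.mk x ⁻¹' (E \ M) := fun hh => hh.2 hy
        have h1 : insert y (Prod.mk x ⁻¹' (E \ M)) ⊆ Prod.mk x ⁻¹' E := by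
          intro z hz
          rcases hz with rfl | hz
          · exact hy.1
          · exact hz.1
        have h2 := (Set.encard_le_encard h1).trans (h x)
        rw [Set.encard_insert_of_notMem hyn] at h2
        push_cast at h2
        exact (ENat.add_le_add_iff_right (by simp)).1 h2)
    have key : (fun x => Measure.count (Prod.mk x ⁻¹' E)) =
        fun x => (Prod.fst '' M).indicator 1 x + Measure.count (Prod.mk x ⁻¹' (E \ M)) := by
      funext x
      have hs : Prod.mk x ⁻¹' E = Prod.mk x ⁻¹' M ∪ Prod.mk x ⁻¹' (E \ M) := by
        rw [← Set.preimage_union, Set.union_diff_cancel Set.inter_subset_left]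
      rw [hs, measure_union]
      · congr 1
        by_cases hx : x ∈ Prod.fst '' M
        · obtain ⟨⟨x', y⟩, hy, rfl⟩ := hx
          have : Prod.mk x' ⁻¹' M = {y} := by
            ext z
            exact ⟨fun hz => hMinj _ _ _ hz hy, fun hz => by rw [hz]; exact hy⟩
          have hx' : x' ∈ Prod.fst '' M := ⟨(x', y), hy, rfl⟩
          rw [this]
          simp only [Set.indicator_of_mem hx']
          simp
        · have : Prod.mk x ⁻¹' M = ∅ := by
            ext z
            simp only [Set.mem_preimage, Set.mem_empty_iff_false, iff_false]
            exact fun hz => hx ⟨(x, z), hz, rfl⟩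
          rw [Set.indicator_of_notMem hx, this]; simp
      · exact Set.disjoint_left.2 fun z h1 h2 => h2.2 h1
      · exact measurable_prodMk_left (hE.diff hMm)
    rw [key]
    exact (measurable_one.indicator hP).add hR

open ProbabilityTheory in
/-- symmetric transport with respect to a kernel -/
def KSym {I : Type*} [MeasurableSpace I] (κ : Kernel I I) (ν : Measure I) : Prop :=
  ∀ f g : I → ENNReal, Measurable f → Measurable g →
    ∫⁻ x, f x * ∫⁻ y, g y ∂κ x ∂ν = ∫⁻ x, g x * ∫⁻ y, f y ∂κ x ∂ν

open ProbabilityTheory in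
/-- iterated transported mass -/
noncomputable def hmass {I : Type*} [MeasurableSpace I] (κ : Kernel I I) (S : ℕ → Set I) :
    ℕ → ℕ → I → ENNReal
  | 0, _ => fun _ => 1
  | m + 1, k => fun x =>
      ∫⁻ y, (S (k + 1)).indicator (fun y => hmass κ S m (k + 1) y * (κ y (S k))⁻¹) y ∂κ x

open ProbabilityTheory in
lemma hmass_measurable {I : Type*} [MeasurableSpace I] (κ : Kernel I I) (S : ℕ → Set I)
    (hS : ∀ k, MeasurableSet (S k)) (m : ℕ) : ∀ k, Measurable (hmass κ S m k) := by
  induction m with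
  | zero => intro k; exact measurable_const
  | succ m ih =>
    intro k
    refine Measurable.lintegral_kernel ?_
    exact ((ih (k + 1)).mul (κ.measurable_coe (hS k)).inv).indicator (hS (k + 1))

open ProbabilityTheory in
lemma hmass_integral {I : Type*} [MeasurableSpace I] (κ : Kernel I I) (S : ℕ → Set I)
    (hS : ∀ k, MeasurableSet (S k)) (hfin : ∀ x k, κ x (S k) ≠ ⊤)
    (hpos : ∀ k, ∀ x ∈ S (k + 1), κ x (S k) ≠ 0)
    (ν : Measure I) (hν : KSym κ ν) (m : ℕ) :
    ∀ k, ∫⁻ x in S k, hmass κ S m k x ∂ν = ν (S (k + m)) := by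
  induction m with
  | zero => intro k; simp [hmass]
  | succ m ih =>
    intro k
    have hg : Measurable ((S (k + 1)).indicator
        (fun y => hmass κ S m (k + 1) y * (κ y (S k))⁻¹)) :=
      ((hmass_measurable κ S hS m (k + 1)).mul (κ.measurable_coe (hS k)).inv).indicator
        (hS (k + 1))
    have h1 := hν ((S k).indicator 1) _ (measurable_one.indicator (hS k)) hg
    have h2 : ∫⁻ x in S k, hmass κ S (m + 1) k x ∂ν =
        ∫⁻ x, (S k).indicator 1 x * ∫⁻ y, (S (k + 1)).indicator
          (fun y => hmass κ S m (k + 1) y * (κ y (S k))⁻¹) y ∂κ x ∂ν := by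
      rw [← lintegral_indicator (hS k)]
      refine lintegral_congr fun x => ?_
      by_cases hx : x ∈ S k <;> simp [hx, hmass]
    rw [h2, h1]
    have h3 := ih (k + 1)
    rw [show k + (m + 1) = k + 1 + m by ring, ← h3, ← lintegral_indicator (hS (k + 1))]
    refine lintegral_congr fun x => ?_
    rw [lintegral_indicator_one (hS k)]
    by_cases hx : x ∈ S (k + 1)
    · simp only [Set.indicator_of_mem hx]
      rw [mul_assoc, ENNReal.inv_mul_cancel (hpos k x hx) (hfin x k), mul_one]
    · simp [hx]

open ProbabilityTheory in
lemma hmass_sum {I : Type*} [MeasurableSpace I] (κ : Kernel I I) (S : ℕ → Set I)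
    (hS : ∀ k, MeasurableSet (S k)) (hfin : ∀ x k, κ x (S k) ≠ ⊤)
    (hpos : ∀ k, ∀ x ∈ S (k + 1), κ x (S k) ≠ 0)
    (hdis : Pairwise (Function.onFun Disjoint S))
    (ν : Measure I) (hν : KSym κ ν) :
    ∫⁻ x in S 0, ∑' m, hmass κ S m 0 x ∂ν = ν (⋃ k, S k) := by
  rw [lintegral_tsum fun m => (hmass_measurable κ S hS m 0).aemeasurable,
    measure_iUnion hdis hS]
  refine tsum_congr fun m => ?_
  rw [hmass_integral κ S hS hfin hpos ν hν m 0, zero_add]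

open ProbabilityTheory in
lemma ksym_of_rect {I : Type*} [MeasurableSpace I] (κ : Kernel I I) [IsFiniteKernel κ]
    (μ : Measure I) [IsFiniteMeasure μ]
    (h : ∀ A B, MeasurableSet A → MeasurableSet B →
      ∫⁻ x in A, κ x B ∂μ = ∫⁻ x in B, κ x A ∂μ) : KSym κ μ := by
  have hsw : (μ ⊗ₘ κ).map Prod.swap = μ ⊗ₘ κ := by
    refine Measure.ext_prod fun {s t} hs ht => ?_
    rw [Measure.map_apply measurable_swap (hs.prod ht), Set.preimage_swap_prod,
      Measure.compProd_apply_prod ht hs, Measure.compProd_apply_prod hs ht, h _ _ ht hs]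
  have hl : ∀ f g : I → ENNReal, Measurable f → Measurable g →
      ∫⁻ x, f x * ∫⁻ y, g y ∂κ x ∂μ = ∫⁻ p, f p.1 * g p.2 ∂(μ ⊗ₘ κ) := by
    intro f g hf hg
    rw [Measure.lintegral_compProd (by fun_prop)]
    refine lintegral_congr fun x => ?_
    simp only
    rw [lintegral_const_mul _ hg]
  intro f g hf hg
  rw [hl f g hf hg, hl g f hg hf]
  conv_lhs => rw [← hsw]
  rw [lintegral_map (by fun_prop) measurable_swap]
  refine lintegral_congr fun p => ?_
  simp [mul_comm]

lemma compSet_countable {I : Type*} (G : I → I → Prop) (hfin : ∀ x : I, {y | G x y}.Finite)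
    (x : I) : (compSet G x).Countable := by
  let U : ℕ → Set I := fun n => Nat.rec {x} (fun _ s => ⋃ w ∈ s, {y | G w y}) n
  have hU : ∀ n, (U n).Countable := by
    intro n
    induction n with
    | zero => exact Set.countable_singleton x
    | succ n ih => exact ih.biUnion fun w _ => (hfin w).countable
  refine (Set.countable_iUnion hU).mono ?_
  intro y hy
  induction hy with
  | refl => exact Set.mem_iUnion.2 ⟨0, rfl⟩
  | tail _ h ih =>
    obtain ⟨n, hn⟩ := Set.mem_iUnion.1 ih
    exact Set.mem_iUnion.2 ⟨n + 1, Set.mem_biUnion hn h⟩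

open ProbabilityTheory in
lemma ksym_count {I : Type*} [MeasurableSpace I] [MeasurableSingletonClass I]
    (G : I → I → Prop) (hsym : Symmetric G)
    (hfin : ∀ x : I, {y | G x y}.Finite)
    (κ : Kernel I I) (hκ : ∀ x, κ x = Measure.count.restrict {y | G x y}) (x₀ : I) :
    KSym κ (Measure.count.restrict (compSet G x₀)) := by
  classical
  have hC := compSet_countable G hfin x₀
  have hl : ∀ f g : I → ENNReal, 
      ∫⁻ x, f x * ∫⁻ y, g y ∂κ x ∂(Measure.count.restrict (compSet G x₀)) =
      ∑' x : compSet G x₀, ∑' y : compSet G x₀, if G x y then f x * g y else 0 := by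
    intro f g
    rw [lintegral_countable _ hC]
    refine tsum_congr fun x => ?_
    have hsub : {y | G x y} ⊆ compSet G x₀ := fun y hy => Relation.ReflTransGen.tail x.2 hy
    have h1 : ∫⁻ y, g y ∂κ x = ∑' y : compSet G x₀, if G x y then g y else 0 := by
      rw [hκ, ← lintegral_indicator (hfin x).measurableSet]
      have h2 : ∫⁻ y, Set.indicator {y | G x y} g y ∂Measure.count =
          ∫⁻ y in compSet G x₀, Set.indicator {y | G x y} g y ∂Measure.count := by
        rw [← lintegral_indicator hC.measurableSet, Set.indicator_indicator,
          Set.inter_eq_right.2 hsub]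
      rw [h2, lintegral_countable _ hC]
      refine tsum_congr fun y => ?_
      simp [Set.indicator_apply]
    rw [h1, Measure.count_singleton, mul_one, ← ENNReal.tsum_mul_left]
    refine tsum_congr fun y => ?_
    simp
  intro f g _ _
  rw [hl, hl, ENNReal.tsum_comm]
  refine tsum_congr fun x => tsum_congr fun y => ?_
  have : G y x ↔ G x y := ⟨fun h => hsym h, fun h => hsym h⟩
  simp [this, mul_comm]

/-- recurrence: for a graphing and a Borel set `A`, almost every `x ∈ A`
whose component is infinite has infinitely many component-mates in `A`. -/
theorem stmt12 {I : Type*} [MeasurableSpace I] [StandardBorelSpace I]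
    (G : I → I → Prop) (hsym : Symmetric G) (hirr : Irreflexive G)
    (hGmeas : MeasurableSet {p : I × I | G p.1 p.2})
    (D : ℕ) (hfin : ∀ x : I, {y | G x y}.Finite) (hdeg : ∀ x : I, {y | G x y}.ncard ≤ D)
    (μ : Measure I) [IsProbabilityMeasure μ]
    (hMP : ∀ A B : Set I, MeasurableSet A → MeasurableSet B →
      ∫ x in A, (degIn G B x : ℝ) ∂μ = ∫ x in B, (degIn G A x : ℝ) ∂μ) (A : Set I) (hA : MeasurableSet A) :
    ∀ᵐ x ∂μ, x ∈ A → (compSet G x).Infinite → (compSet G x ∩ A).Infinite := by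
  classical
  have hNm : ∀ x, MeasurableSet {y | G x y} := fun x => (hfin x).measurableSet
  have henc : ∀ x, {y | G x y}.encard ≤ D := by
    intro x
    rw [← (hfin x).cast_ncard_eq]
    exact_mod_cast hdeg x
  have hkm : Measurable (fun x => (Measure.count.restrict {y | G x y} : Measure I)) := by
    refine Measure.measurable_of_measurable_coe _ fun B hB => ?_
    have := count_section_measurable D ({p : I × I | G p.1 p.2} ∩ Prod.snd ⁻¹' B)
      (hGmeas.inter (measurable_snd hB))
      (fun x => (Set.encard_le_encard (fun y hy => hy.1)).trans (henc x))
    convert this using 2 with x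
    rw [Measure.restrict_apply hB, Set.inter_comm]
    rfl
  let κ : ProbabilityTheory.Kernel I I := ⟨fun x => Measure.count.restrict {y | G x y}, hkm⟩
  have hκ : ∀ x, κ x = Measure.count.restrict {y | G x y} := fun x => rfl
  have hκap : ∀ x B, MeasurableSet B → κ x B = (degIn G B x : ENNReal) := by
    intro x B hB
    rw [hκ, Measure.restrict_apply hB]
    have hf : {y | y ∈ B ∧ G x y}.Finite := (hfin x).subset fun y hy => hy.2
    rw [show B ∩ {y | G x y} = {y | y ∈ B ∧ G x y} from rfl, Measure.count_apply hf.measurableSet,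
      ← hf.cast_ncard_eq]
    rfl
  have hdegle : ∀ x B, degIn G B x ≤ D := fun x B =>
    (Set.ncard_le_ncard (fun y hy => hy.2) (hfin x)).trans (hdeg x)
  have hκpos : ∀ x B, κ x B ≠ 0 ↔ ∃ y ∈ B, G x y := by
    intro x B
    rw [hκ, Measure.restrict_apply' (hNm x), Ne, Measure.count_eq_zero_iff, ← Ne,
      ← Set.nonempty_iff_ne_empty]
    rfl
  have hfk : ProbabilityTheory.IsFiniteKernel κ := by
    refine ⟨⟨D, by simp, fun x => ?_⟩⟩
    rw [hκap x _ .univ]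
    exact_mod_cast hdegle x _
  have hsymμ : KSym κ μ := by
    refine ksym_of_rect κ μ fun A B hA hB => ?_
    have hcv : ∀ A B, MeasurableSet A → MeasurableSet B →
        ∫⁻ x in A, κ x B ∂μ = ENNReal.ofReal (∫ x in A, (degIn G B x : ℝ) ∂μ) := by
      intro A B hA hB
      have hm : Measurable (fun x => (degIn G B x : ℝ)) := by
        have := (κ.measurable_coe hB).ennreal_toReal
        convert this using 2 with x
        rw [hκap x B hB]; simp
      rw [ofReal_integral_eq_lintegral_ofReal]
      · refine lintegral_congr fun x => ?_
        rw [hκap x B hB]; simp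
      · refine Integrable.of_bound hm.aestronglyMeasurable (D : ℝ) (Filter.Eventually.of_forall fun x => ?_)
        simpa using hdegle x B
      · exact Filter.Eventually.of_forall fun x => by positivity
    rw [hcv A B hA hB, hcv B A hB hA, hMP A B hA hB]
  -- spheres around `A`
  let nb : Set I → Set I := fun s => {x | κ x s ≠ 0}
  have hnbm : ∀ s, MeasurableSet s → MeasurableSet (nb s) := fun s hs =>
    (κ.measurable_coe hs) (measurableSet_singleton 0).compl
  let B : ℕ → Set I := fun n => Nat.rec A (fun _ s => s ∪ nb s) n
  have hBs : ∀ n, B (n + 1) = B n ∪ nb (B n) := fun n => rfl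
  have hBm : ∀ n, MeasurableSet (B n) := by
    intro n
    induction n with
    | zero => exact hA
    | succ n ih => exact ih.union (hnbm _ ih)
  have hBmono : Monotone B := monotone_nat_of_le_succ fun n => Set.subset_union_left
  let S : ℕ → Set I := disjointed B
  have hS0 : S 0 = A := disjointed_bot B
  have hSs : ∀ n, S (n + 1) = B (n + 1) \ B n := fun n =>
    hBmono.disjointed_succ (not_isMax n)
  have hSm : ∀ n, MeasurableSet (S n) := fun n => MeasurableSet.disjointed hBm n
  have hSpos : ∀ k, ∀ x ∈ S (k + 1), κ x (S k) ≠ 0 := by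
    intro k x hx
    rw [hSs] at hx
    have hx1 : x ∈ nb (B k) := hx.1.resolve_left hx.2
    obtain ⟨y, hy, hxy⟩ := (hκpos x _).1 hx1
    refine (hκpos x _).2 ⟨y, ?_, hxy⟩
    cases k with
    | zero => rw [hS0]; exact hy
    | succ j =>
      rw [hSs]
      exact ⟨hy, fun hyj => hx.2 (Or.inr ((hκpos x _).2 ⟨y, hyj, hxy⟩))⟩
  have hSfin : ∀ x k, κ x (S k) ≠ ⊤ := fun x k => measure_ne_top _ _
  have hsum := hmass_sum κ S hSm hSfin hSpos (disjoint_disjointed B)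
  set H : I → ENNReal := fun x => ∑' m, hmass κ S m 0 x with hH
  have hHm : Measurable H := Measurable.ennreal_tsum fun m => hmass_measurable κ S hSm m 0
  rw [hS0] at hsum
  -- the null set
  let N : ℕ → Set I := fun n => Nat.rec (A ∩ H ⁻¹' {⊤}) (fun _ s => nb s) n
  have hNnull : ∀ n, MeasurableSet (N n) ∧ μ (N n) = 0 := by
    intro n
    induction n with
    | zero =>
      have hm : MeasurableSet (H ⁻¹' {⊤}) := hHm (measurableSet_singleton _)
      refine ⟨hA.inter hm, ?_⟩
      have h1 : ∀ᵐ x ∂μ.restrict A, H x < ⊤ := by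
        refine ae_lt_top hHm ?_
        rw [hsum μ hsymμ]
        exact measure_ne_top _ _
      rw [ae_restrict_iff' hA] at h1
      rw [← nonpos_iff_eq_zero, ← ae_iff.1 h1]
      refine measure_mono ?_
      rintro x ⟨hxA, hx⟩ hc
      exact (hc hxA).ne hx
    | succ n ih =>
      refine ⟨hnbm _ ih.1, ?_⟩
      have h1 := hsymμ 1 ((N n).indicator 1) measurable_one (measurable_one.indicator ih.1)
      have h2 : ∫⁻ x, (N n).indicator 1 x * ∫⁻ y, (1 : I → ENNReal) y ∂κ x ∂μ = 0 := by
        rw [lintegral_eq_zero_iff' ]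
        · have : ∀ᵐ x ∂μ, x ∉ N n := measure_eq_zero_iff_ae_notMem.1 ih.2
          filter_upwards [this] with x hx
          simp [hx]
        · exact ((measurable_one.indicator ih.1).mul
            (measurable_one.lintegral_kernel)).aemeasurable
      rw [h2] at h1
      simp only [Pi.one_apply, one_mul, lintegral_indicator_one ih.1] at h1
      rw [lintegral_eq_zero_iff (κ.measurable_coe ih.1)] at h1
      exact ae_iff.1 h1
  have hae : ∀ᵐ x ∂μ, ∀ n, x ∉ N n :=
    ae_all_iff.2 fun n => measure_eq_zero_iff_ae_notMem.1 (hNnull n).2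
  filter_upwards [hae] with x hx hxA hinf hfinA
  set C := compSet G x with hC
  have hCm : MeasurableSet C := (compSet_countable G hfin x).measurableSet
  have hall : ∀ y ∈ C, y ∈ A → H y ≠ ⊤ := by
    intro y hy hyA hyH
    have : ∃ n, x ∈ N n := by
      refine Relation.ReflTransGen.head_induction_on (motive := fun z _ => ∃ n, z ∈ N n) hy
        ⟨0, hyA, hyH⟩ ?_
      rintro a c hac _ ⟨n, hn⟩
      exact ⟨n + 1, (hκpos a _).2 ⟨c, hn, hac⟩⟩
    obtain ⟨n, hn⟩ := this
    exact hx n hn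
  have hcov : C ⊆ ⋃ k, S k := by
    rw [show (⋃ k, S k) = ⋃ k, B k from iUnion_disjointed]
    intro y hy
    induction hy with
    | refl => exact Set.mem_iUnion.2 ⟨0, hxA⟩
    | tail _ h ih =>
      obtain ⟨n, hn⟩ := Set.mem_iUnion.1 ih
      exact Set.mem_iUnion.2 ⟨n + 1, Or.inr ((hκpos _ _).2 ⟨_, hn, hsym h⟩)⟩
  have hfinal := hsum _ (ksym_count G hsym hfin κ hκ x)
  rw [Measure.restrict_apply' hCm, Set.inter_eq_right.2 hcov,
    Measure.count_apply_infinite hinf, Measure.restrict_restrict hA, Set.inter_comm,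
    lintegral_countable _ hfinA.countable] at hfinal
  have : Finite ↑(C ∩ A) := hfinA
  have := Fintype.ofFinite ↑(C ∩ A)
  rw [tsum_fintype] at hfinal
  refine ENNReal.sum_ne_top.2 ?_ hfinal
  rintro ⟨y, hy⟩ _
  simpa using hall y hy.1 hy.2
end
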